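/- Let (R, r) be a dévissage setup and let M be a finitely generated projective R/rR-module which is stably free (M ⊕ (R/rR)^k ≅ (R/rR)^d for some k, d). Then: (a) for every n ≥ 1 there exists a finitely generated projective R/rⁿR-module M_(n) with M_(n)/rM_(n) ≅ M, and any two such lifts are isomorphic as R/rⁿR-modules; (b) there exists a finitely generated projective R-module M_(∞) with M_(∞)/rM_(∞) ≅ M, unique up to isomorphism; (c) if M has constant rank, then so do M_(n) and M_(∞). -/

import Mathlib

open Pointwise

universe u

section Core

variable {R : Type u} [CommRing R]

/-- A dévissage setup: `R` is `r`-torsion-free and `r`-adically complete and separated. -/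
structure IsDevissageSetup (R : Type u) [CommRing R] (r : R) : Prop where
  torsionFree : ∀ x : R, r * x = 0 → x = 0
  adicComplete : IsAdicComplete (Ideal.span {r}) R

/-- `Q` has constant rank over `A`: localization at every prime is free of a fixed rank. -/
def ConstRank (A : Type u) [CommRing A] (Q : Type u) [AddCommGroup Q] [Module A Q] : Prop :=
  ∃ c : ℕ, ∀ (p : Ideal A) (_ : p.IsPrime),
    Nonempty ((LocalizedModule p.primeCompl Q) ≃ₗ[Localization.AtPrime p]
      (Fin c → Localization.AtPrime p))

/-- finitely generated, projective, of constant rank -/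
def FinProjConstRank (A : Type u) [CommRing A] (Q : Type u) [AddCommGroup Q] [Module A Q] : Prop :=
  Module.Finite A Q ∧ Module.Projective A Q ∧ ConstRank A Q

/-- the subquotient `rⁿM/rⁿ⁺¹M`, realized as a submodule of `M/rⁿ⁺¹M`. -/
def muQuotSub (r : R) (M : Type u) [AddCommGroup M] [Module R M] (n : ℕ) :
    Submodule R (M ⧸ (r ^ (n + 1) • (⊤ : Submodule R M))) :=
  (r ^ n • (⊤ : Submodule R M)).map (r ^ (n + 1) • (⊤ : Submodule R M)).mkQ

theorem muQuotSub_isTorsionBySet (r : R) (M : Type u) [AddCommGroup M] [Module R M] (n : ℕ) :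
    Module.IsTorsionBySet R (muQuotSub r M n) ((Ideal.span {r} : Ideal R) : Set R) := by
  refine (Module.isTorsionBySet_span_singleton_iff r).mpr ?_
  rintro ⟨x, hx⟩
  obtain ⟨m, hm, rfl⟩ := hx
  obtain ⟨m', -, rfl⟩ := hm
  apply Subtype.ext
  show r • ((r ^ (n + 1) • (⊤ : Submodule R M)).mkQ
      ((DistribMulAction.toLinearMap R M (r ^ n) : M →ₗ[R] M) m')) = 0
  rw [← map_smul]
  rw [Submodule.mkQ_apply, Submodule.Quotient.mk_eq_zero]
  show r • r ^ n • m' ∈ r ^ (n + 1) • (⊤ : Submodule R M)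
  rw [smul_smul, ← pow_succ']
  exact Submodule.smul_mem_pointwise_smul _ _ _ Submodule.mem_top

/-- `M` has finite projective `(r,μ)`-dévissage. -/
def HasFinProjMuDevissage (r : R) (M : Type u) [AddCommGroup M] [Module R M] : Prop :=
  ∀ n : ℕ,
    letI := (muQuotSub_isTorsionBySet r M n).module
    FinProjConstRank (R ⧸ (Ideal.span {r} : Ideal R)) (muQuotSub r M n)

/-- `M` has bounded `r^∞`-torsion. -/
def BoundedRTorsion (r : R) (M : Type u) [AddCommGroup M] [Module R M] : Prop :=
  ∃ N : ℕ, 1 ≤ N ∧ ∀ x : M, (∃ k : ℕ, r ^ k • x = 0) → r ^ N • x = 0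

end Core

section Lift

variable {R : Type u} [CommRing R]

/-- `P` is a lift of `M` to a finitely generated projective `R/rⁿR`-module,
i.e. `P` is killed by `rⁿ`, finitely generated projective over `R/rⁿR`, and `P/rP ≅ M`. -/
def IsLiftOfLevel (r : R) (n : ℕ) (M : Type u) [AddCommGroup M] [Module R M]
    (P : Type u) [AddCommGroup P] [Module R P] : Prop :=
  (∃ h : Module.IsTorsionBySet R P ((Ideal.span {r ^ n} : Ideal R) : Set R),
    letI := h.module
    Module.Finite (R ⧸ (Ideal.span {r ^ n} : Ideal R)) P ∧
      Module.Projective (R ⧸ (Ideal.span {r ^ n} : Ideal R)) P) ∧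
  Nonempty ((P ⧸ (r • (⊤ : Submodule R P))) ≃ₗ[R] M)

/-- `P` is a lift of `M` to a finitely generated projective `R`-module: `P` is finitely
generated projective over `R` and `P/rP ≅ M`. -/
def IsLiftInfty (r : R) (M : Type u) [AddCommGroup M] [Module R M]
    (P : Type u) [AddCommGroup P] [Module R P] : Prop :=
  Module.Finite R P ∧ Module.Projective R P ∧
    Nonempty ((P ⧸ (r • (⊤ : Submodule R P))) ≃ₗ[R] M)

section Helpers

open TensorProduct

/-- Uniqueness of projective lifts along an element of the Jacobson radical. -/
theorem surj_of_mod {B : Type*} [CommRing B] (b : B) (hb : b ∈ Ideal.jacobson (⊥ : Ideal B))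
    {P Q : Type*} [AddCommGroup P] [Module B P] [AddCommGroup Q] [Module B Q] [Module.Finite B Q]
    (g : P →ₗ[B] Q) (h : ∀ q, ∃ p q', q = g p + b • q') : Function.Surjective g := by
  rw [← LinearMap.range_eq_top, eq_top_iff]
  refine Submodule.le_of_le_smul_of_le_jacobson_bot (I := Ideal.span {b}) Module.Finite.fg_top
    ((Ideal.span_singleton_le_iff_mem _).2 hb) ?_
  intro q _
  obtain ⟨p, q', rfl⟩ := h q
  exact Submodule.add_mem_sup (LinearMap.mem_range_self _ _)
    (Submodule.smul_mem_smul (Ideal.mem_span_singleton_self b) trivial)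

theorem lift_unique_aux {B : Type*} [CommRing B] (b : B) (hb : b ∈ Ideal.jacobson (⊥ : Ideal B))
    {P Q N : Type*} [AddCommGroup P] [Module B P] [Module.Finite B P] [Module.Projective B P]
    [AddCommGroup Q] [Module B Q] [Module.Finite B Q] [Module.Projective B Q]
    [AddCommGroup N] [Module B N]
    (f : P →ₗ[B] N) (hf : Function.Surjective f) (hfk : ∀ p, f p = 0 → ∃ p', p = b • p')
    (g : Q →ₗ[B] N) (hg : Function.Surjective g) (hgk : ∀ p, g p = 0 → ∃ p', p = b • p') :
    Nonempty (P ≃ₗ[B] Q) := by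
  obtain ⟨s, hs⟩ := Module.projective_lifting_property g f hg
  obtain ⟨t, ht⟩ := Module.projective_lifting_property f g hf
  have hs' : ∀ x, g (s x) = f x := fun x => LinearMap.congr_fun hs x
  have ht' : ∀ x, f (t x) = g x := fun x => LinearMap.congr_fun ht x
  have h1 : Function.Surjective s := by
    refine surj_of_mod b hb s fun q => ?_
    obtain ⟨q', hq'⟩ := hgk (q - s (t q)) (by rw [map_sub, hs', ht', sub_self])
    exact ⟨t q, q', by rw [← hq']; abel⟩
  have h2 : Function.Surjective (t ∘ₗ s) := by
    refine surj_of_mod b hb _ fun q => ?_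
    obtain ⟨q', hq'⟩ := hfk (q - t (s q)) (by rw [map_sub, ht', hs', sub_self])
    exact ⟨q, q', by rw [← hq', LinearMap.comp_apply]; abel⟩
  have h3 := OrzechProperty.injective_of_surjective_endomorphism _ h2
  have h4 : Function.Injective s := by
    rw [LinearMap.coe_comp] at h3
    exact h3.of_comp
  exact ⟨LinearEquiv.ofBijective s ⟨h4, h1⟩⟩

theorem constRank_aux {B A : Type u} [CommRing B] [CommRing A] [Algebra B A]
    (b : B) (hb : b ∈ Ideal.jacobson (⊥ : Ideal B))
    (hsurj : Function.Surjective (algebraMap B A))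
    (hker : RingHom.ker (algebraMap B A) = Ideal.span {b})
    {P N : Type u} [AddCommGroup P] [Module B P] [Module.Finite B P] [Module.Projective B P]
    [AddCommGroup N] [Module B N] [Module A N] [IsScalarTower B A N]
    (f : P →ₗ[B] N) (hf : Function.Surjective f) (hfk : ∀ p, f p = 0 → ∃ p', p = b • p')
    (hN : ConstRank A N) : ConstRank B P := by
  have hb0 : algebraMap B A b = 0 := by
    rw [← RingHom.mem_ker, hker]; exact Ideal.mem_span_singleton_self b
  have hbc : IsBaseChange A f := by
    have hone : ∀ z : A ⊗[B] P, ∃ p, z = 1 ⊗ₜ p := by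
      intro z
      induction z with
      | zero => exact ⟨0, by simp⟩
      | tmul a p =>
        obtain ⟨c, rfl⟩ := hsurj a
        exact ⟨c • p, by rw [Algebra.algebraMap_eq_smul_one, TensorProduct.smul_tmul]⟩
      | add x y hx hy =>
        obtain ⟨p, rfl⟩ := hx
        obtain ⟨q, rfl⟩ := hy
        exact ⟨p + q, by rw [TensorProduct.tmul_add]⟩
    constructor
    · rw [injective_iff_map_eq_zero]
      intro z hz
      obtain ⟨p, rfl⟩ := hone z
      have hz' : f p = 0 := by simpa using hz
      obtain ⟨p', rfl⟩ := hfk p hz'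
      rw [← TensorProduct.smul_tmul, ← Algebra.algebraMap_eq_smul_one, hb0, TensorProduct.zero_tmul]
    · intro n
      obtain ⟨p, rfl⟩ := hf n
      exact ⟨1 ⊗ₜ p, by simp⟩
  obtain ⟨c, hc⟩ := hN
  refine ⟨c, fun p hp => ?_⟩
  obtain ⟨m, hm, hpm⟩ := Ideal.exists_le_maximal p hp.ne_top
  have hbm : Ideal.span {b} ≤ m := by
    rw [Ideal.span_singleton_le_iff_mem]
    exact (Ideal.mem_jacobson_bot.1 hb |> fun _ => (Ideal.mem_sInf.1 hb) ⟨bot_le, hm⟩)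
  have hq : (m.map (algebraMap B A)).IsPrime :=
    haveI := hm.isPrime
    Ideal.map_isPrime_of_surjective hsurj (hker.le.trans hbm)
  let q : PrimeSpectrum A := ⟨_, hq⟩
  have hqm : q.comap (algebraMap B A) = ⟨m, hm.isPrime⟩ := by
    ext1
    show Ideal.comap _ (Ideal.map _ m) = m
    rw [Ideal.comap_map_of_surjective _ hsurj, ← RingHom.ker_eq_comap_bot, hker]
    exact sup_eq_left.2 hbm
  have h1 : Module.rankAtStalk (R := A) N q = c := by
    obtain ⟨e⟩ := hc q.asIdeal hq
    haveI := q.isPrime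
    rw [Module.rankAtStalk, e.finrank_eq, Module.finrank_fin_fun]
  have h2 : Module.rankAtStalk (R := B) P ⟨p, hp⟩ = c := by
    rw [Module.rankAtStalk_eq_of_le_of_finite_of_flat (q := ⟨m, hm.isPrime⟩) P hpm, ← hqm,
      ← Module.rankAtStalk_baseChange, Module.rankAtStalk_eq_of_equiv hbc.equiv, h1]
  haveI : Module.Free (Localization.AtPrime p) (LocalizedModule p.primeCompl P) :=
    Module.free_of_flat_of_isLocalRing
  exact ⟨LinearEquiv.ofFinrankEq _ _ (by rw [Module.finrank_fin_fun]; exact h2)⟩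

theorem lift_exists_aux {R : Type u} [CommRing R] (r : R)
    (hr : r ∈ Ideal.jacobson (⊥ : Ideal R)) (M : Type u) [AddCommGroup M] [Module R M]
    (hrM : ∀ m : M, r • m = 0) (k d : ℕ)
    (e : (M × (Fin k → R ⧸ (Ideal.span {r} : Ideal R)))
        ≃ₗ[R] (Fin d → R ⧸ (Ideal.span {r} : Ideal R))) :
    ∃ (P : Type u) (_ : AddCommGroup P) (_ : Module R P), IsLiftInfty r M P := by
  let π : ∀ n : ℕ, (Fin n → R) →ₗ[R] (Fin n → R ⧸ (Ideal.span {r} : Ideal R)) := fun n =>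
    LinearMap.compLeft (Ideal.span {r} : Ideal R).mkQ (Fin n)
  have hπ : ∀ n, Function.Surjective (π n) := fun n x => by
    choose y hy using fun i => Submodule.mkQ_surjective _ (x i)
    exact ⟨y, funext hy⟩
  have hπk : ∀ n x, π n x = 0 → ∃ y, x = r • y := fun n x hx => by
    have : ∀ i, ∃ y, x i = r * y := fun i => by
      have := congr_fun hx i
      exact Ideal.mem_span_singleton.1 ((Submodule.Quotient.mk_eq_zero _).1 this)
    choose y hy using this
    exact ⟨y, funext hy⟩
  have hrπ : ∀ n x, π n (r • x) = 0 := fun n x => funext fun i =>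
    (Submodule.Quotient.mk_eq_zero _).2 (Ideal.mem_span_singleton.2 ⟨x i, rfl⟩)
  obtain ⟨g, hg⟩ := Module.projective_lifting_property (π k)
    (LinearMap.snd R _ _ ∘ₗ e.symm.toLinearMap ∘ₗ π d) (hπ k)
  have hg' : ∀ x, π k (g x) = (e.symm (π d x)).2 := fun x => LinearMap.congr_fun hg x
  have hgs : Function.Surjective g := by
    refine surj_of_mod r hr g fun q => ?_
    obtain ⟨x, hx⟩ := hπ d (e (0, π k q))
    obtain ⟨y, hy⟩ := hπk k (q - g x) (by rw [map_sub, hg', hx]; simp)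
    exact ⟨x, y, by rw [← hy]; abel⟩
  obtain ⟨s, hs⟩ := Module.projective_lifting_property g LinearMap.id hgs
  have hs' : ∀ x, g (s x) = x := fun x => LinearMap.congr_fun hs x
  let ρ : (Fin d → R) →ₗ[R] LinearMap.ker g :=
    LinearMap.codRestrict _ (LinearMap.id - s ∘ₗ g) fun x => by simp [hs']
  have hρ : ρ ∘ₗ (LinearMap.ker g).subtype = LinearMap.id := by
    ext1 x
    apply Subtype.ext
    have : g x = 0 := x.2
    simp [ρ, this]
  let f : LinearMap.ker g →ₗ[R] M :=
    LinearMap.fst R _ _ ∘ₗ e.symm.toLinearMap ∘ₗ π d ∘ₗ (LinearMap.ker g).subtype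
  have hf : Function.Surjective f := by
    intro m
    obtain ⟨v, hv⟩ := hπ d (e (m, 0))
    obtain ⟨w, hw⟩ := hπk k (g v) (by rw [hg', hv]; simp)
    refine ⟨⟨v - r • s w, by simp [hs', hw]⟩, ?_⟩
    show (e.symm (π d (v - r • s w))).1 = m
    rw [map_sub, hrπ, hv]; simp
  have hfk : LinearMap.ker f = r • (⊤ : Submodule R (LinearMap.ker g)) := by
    apply le_antisymm
    · intro x hx
      have h1 : (e.symm (π d x)).1 = 0 := hx
      have h2 : (e.symm (π d x)).2 = 0 := by
        rw [← hg', show g x = 0 from x.2, map_zero]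
      have h3 : e.symm (π d x) = 0 := Prod.ext h1 h2
      obtain ⟨u, hu⟩ := hπk d x (by simpa using h3)
      have h4 : x = r • ρ u := by
        rw [← map_smul, ← hu]
        exact (LinearMap.congr_fun hρ x).symm
      rw [h4]
      exact Submodule.smul_mem_pointwise_smul _ _ _ Submodule.mem_top
    · rintro _ ⟨x, -, rfl⟩
      show f (r • x) = 0
      rw [map_smul, hrM]
  refine ⟨LinearMap.ker g, inferInstance, inferInstance, ?_, ?_, ?_⟩
  · exact Module.Finite.of_surjective ρ fun x => ⟨x, LinearMap.congr_fun hρ x⟩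
  · exact Module.Projective.of_split _ _ hρ
  · rw [← hfk]
    exact ⟨f.quotKerEquivOfSurjective hf⟩

/-- A lift datum gives a surjection. -/
theorem map_of_equiv {R : Type u} [CommRing R] (r : R) (M : Type u) [AddCommGroup M] [Module R M]
    (P : Type u) [AddCommGroup P] [Module R P]
    (h : Nonempty ((P ⧸ (r • (⊤ : Submodule R P))) ≃ₗ[R] M)) :
    ∃ f : P →ₗ[R] M, Function.Surjective f ∧ ∀ p, f p = 0 → ∃ p', p = r • p' := by
  obtain ⟨e⟩ := h
  refine ⟨e.toLinearMap ∘ₗ Submodule.mkQ _, e.surjective.comp (Submodule.mkQ_surjective _), ?_⟩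
  intro p hp
  have hp' : e (Submodule.mkQ _ p) = 0 := hp
  rw [e.map_eq_zero_iff, Submodule.mkQ_apply, Submodule.Quotient.mk_eq_zero] at hp'
  obtain ⟨p', -, rfl⟩ := hp'
  exact ⟨p', rfl⟩

theorem lift_level_aux {R : Type u} [CommRing R] (r : R) (M : Type u) [AddCommGroup M] [Module R M]
    (P : Type u) [AddCommGroup P] [Module R P] (h : IsLiftInfty r M P) (n : ℕ) (hn : 1 ≤ n) :
    IsLiftOfLevel r n M (P ⧸ (r ^ n • (⊤ : Submodule R P))) := by
  obtain ⟨h1, h2, ⟨e⟩⟩ := h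
  refine ⟨?_, ?_⟩
  · have ht : Module.IsTorsionBySet R (P ⧸ (r ^ n • (⊤ : Submodule R P)))
        ((Ideal.span {r ^ n} : Ideal R) : Set R) := by
      refine (Module.isTorsionBySet_span_singleton_iff _).mpr ?_
      intro x
      obtain ⟨x, rfl⟩ := Submodule.mkQ_surjective _ x
      rw [← map_smul, Submodule.mkQ_apply, Submodule.Quotient.mk_eq_zero]
      exact Submodule.smul_mem_pointwise_smul _ _ _ Submodule.mem_top
    refine ⟨ht, ?_⟩
    letI := ht.module
    haveI : IsScalarTower R (R ⧸ (Ideal.span {r ^ n} : Ideal R))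
      (P ⧸ (r ^ n • (⊤ : Submodule R P))) := ht.isScalarTower
    have heq : (Ideal.span {r ^ n} : Ideal R) • (⊤ : Submodule R P) = r ^ n • ⊤ :=
      Submodule.ideal_span_singleton_smul _ _
    let e' := ((TensorProduct.quotTensorEquivQuotSMul P (Ideal.span {r ^ n} : Ideal R)).trans
      (Submodule.quotEquivOfEq _ _ heq)).extendScalarsOfSurjective
        (S := R ⧸ (Ideal.span {r ^ n} : Ideal R)) Ideal.Quotient.mk_surjective
    exact ⟨Module.Finite.equiv e', Module.Projective.of_equiv e'⟩
  · have hle : r ^ n • (⊤ : Submodule R P) ≤ r • ⊤ := by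
      rintro _ ⟨x, -, rfl⟩
      obtain ⟨j, rfl⟩ := Nat.exists_eq_add_of_le hn
      show r ^ (1 + j) • x ∈ _
      rw [pow_add, pow_one, mul_smul]
      exact Submodule.smul_mem_pointwise_smul _ _ _ Submodule.mem_top
    have heq : r • (⊤ : Submodule R (P ⧸ (r ^ n • (⊤ : Submodule R P)))) =
        (r • (⊤ : Submodule R P)).map (r ^ n • (⊤ : Submodule R P)).mkQ := by
      apply le_antisymm
      · rintro _ ⟨x, -, rfl⟩
        obtain ⟨x, rfl⟩ := Submodule.mkQ_surjective _ x
        exact ⟨r • x, Submodule.smul_mem_pointwise_smul _ _ _ Submodule.mem_top, rfl⟩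
      · rintro _ ⟨_, ⟨x, -, rfl⟩, rfl⟩
        show Submodule.mkQ _ (r • x) ∈ _
        rw [map_smul]
        exact Submodule.smul_mem_pointwise_smul _ _ _ Submodule.mem_top
    exact ⟨(Submodule.quotEquivOfEq _ _ heq).trans
      ((Submodule.quotientQuotientEquivQuotient _ _ hle).trans e)⟩

end Helpers

end Lift

/-- Lemma `lemma_pour_ko_1`, third point: for a dévissage setup `(R,r)` and a
finitely generated projective stably free `R/rR`-module `M`: (a) for each `n ≥ 1` there is a lift
of `M` to a finitely generated projective `R/rⁿR`-module, unique up to isomorphism; (b) the same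
for lifts to finitely generated projective `R`-modules; (c) if `M` has constant rank, so does
every such lift. -/
theorem lift_of_stably_free {R : Type u} [CommRing R] (r : R) (hR : IsDevissageSetup R r)
    (M : Type u) [AddCommGroup M] [Module R M]
    (hM : Module.IsTorsionBySet R M ((Ideal.span {r} : Ideal R) : Set R))
    (hMfin : letI := hM.module; Module.Finite (R ⧸ (Ideal.span {r} : Ideal R)) M)
    (hMproj : letI := hM.module; Module.Projective (R ⧸ (Ideal.span {r} : Ideal R)) M)
    (hMsf : letI := hM.module; ∃ k d : ℕ,
      Nonempty ((M × (Fin k → R ⧸ (Ideal.span {r} : Ideal R)))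
        ≃ₗ[R ⧸ (Ideal.span {r} : Ideal R)] (Fin d → R ⧸ (Ideal.span {r} : Ideal R)))) :
    (∀ n : ℕ, 1 ≤ n →
      (∃ (P : Type u) (_ : AddCommGroup P) (_ : Module R P), IsLiftOfLevel r n M P) ∧
      (∀ (P : Type u) (_ : AddCommGroup P) (_ : Module R P)
        (P' : Type u) (_ : AddCommGroup P') (_ : Module R P'),
        IsLiftOfLevel r n M P → IsLiftOfLevel r n M P' → Nonempty (P ≃ₗ[R] P'))) ∧
    ((∃ (P : Type u) (_ : AddCommGroup P) (_ : Module R P), IsLiftInfty r M P) ∧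
      (∀ (P : Type u) (_ : AddCommGroup P) (_ : Module R P)
        (P' : Type u) (_ : AddCommGroup P') (_ : Module R P'),
        IsLiftInfty r M P → IsLiftInfty r M P' → Nonempty (P ≃ₗ[R] P'))) ∧
    ((letI := hM.module; ConstRank (R ⧸ (Ideal.span {r} : Ideal R)) M) →
      (∀ n : ℕ, 1 ≤ n → ∀ (P : Type u) (_ : AddCommGroup P) (_ : Module R P),
        IsLiftOfLevel r n M P →
        ∀ h : Module.IsTorsionBySet R P ((Ideal.span {r ^ n} : Ideal R) : Set R),
          (letI := h.module; ConstRank (R ⧸ (Ideal.span {r ^ n} : Ideal R)) P)) ∧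
      (∀ (P : Type u) (_ : AddCommGroup P) (_ : Module R P),
        IsLiftInfty r M P → ConstRank R P)) := by
  have hr : r ∈ Ideal.jacobson (⊥ : Ideal R) := by
    haveI := hR.adicComplete
    exact IsAdicComplete.le_jacobson_bot _ (Ideal.mem_span_singleton_self r)
  have hrM : ∀ m : M, r • m = 0 := (Module.isTorsionBySet_span_singleton_iff r).1 hM
  have hrn : ∀ n : ℕ, Ideal.Quotient.mk (Ideal.span {r ^ n} : Ideal R) r ∈
      Ideal.jacobson (⊥ : Ideal (R ⧸ (Ideal.span {r ^ n} : Ideal R))) := by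
    intro n
    refine Ideal.mem_sInf.2 fun {J} hJ => hJ.2.isPrime.mem_of_pow_mem n ?_
    rw [← map_pow]
    rw [Ideal.Quotient.eq_zero_iff_mem.2 (Ideal.mem_span_singleton_self _)]
    exact J.zero_mem
  have hMn : ∀ n : ℕ, 1 ≤ n →
      Module.IsTorsionBySet R M ((Ideal.span {r ^ n} : Ideal R) : Set R) := by
    intro n hn
    refine (Module.isTorsionBySet_span_singleton_iff _).mpr ?_
    intro x
    obtain ⟨j, rfl⟩ := Nat.exists_eq_add_of_le' hn
    rw [pow_succ, mul_smul, hrM, smul_zero]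
  have hex : ∃ (P : Type u) (_ : AddCommGroup P) (_ : Module R P), IsLiftInfty r M P := by
    letI := hM.module
    haveI : IsScalarTower R (R ⧸ (Ideal.span {r} : Ideal R)) M := hM.isScalarTower
    obtain ⟨k, d, ⟨e⟩⟩ := hMsf
    exact lift_exists_aux r hr M hrM k d (e.restrictScalars R)
  refine ⟨fun n hn => ⟨?_, ?_⟩, ⟨hex, ?_⟩, fun hc => ⟨?_, ?_⟩⟩
  · obtain ⟨P, _, _, hP⟩ := hex
    exact ⟨_, _, _, lift_level_aux r M P hP n hn⟩
  · rintro P _ _ P' _ _ ⟨⟨h, h1, h2⟩, h3⟩ ⟨⟨h', h1', h2'⟩, h3'⟩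
    obtain ⟨f, hf, hfk⟩ := map_of_equiv r M P h3
    obtain ⟨g, hg, hgk⟩ := map_of_equiv r M P' h3'
    letI := h.module
    letI := h'.module
    letI := (hMn n hn).module
    haveI : IsScalarTower R (R ⧸ (Ideal.span {r ^ n} : Ideal R)) P := h.isScalarTower
    haveI : IsScalarTower R (R ⧸ (Ideal.span {r ^ n} : Ideal R)) P' := h'.isScalarTower
    haveI : IsScalarTower R (R ⧸ (Ideal.span {r ^ n} : Ideal R)) M := (hMn n hn).isScalarTower
    have hsur : Function.Surjective (algebraMap R (R ⧸ (Ideal.span {r ^ n} : Ideal R))) :=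
      Ideal.Quotient.mk_surjective
    obtain ⟨e⟩ := lift_unique_aux _ (hrn n) (f.extendScalarsOfSurjective hsur) hf hfk
      (g.extendScalarsOfSurjective hsur) hg hgk
    exact ⟨e.restrictScalars R⟩
  · rintro P _ _ P' _ _ ⟨h1, h2, h3⟩ ⟨h1', h2', h3'⟩
    obtain ⟨f, hf, hfk⟩ := map_of_equiv r M P h3
    obtain ⟨g, hg, hgk⟩ := map_of_equiv r M P' h3'
    exact lift_unique_aux r hr f hf hfk g hg hgk
  · rintro n hn P _ _ ⟨⟨h, h1, h2⟩, h3⟩ -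
    obtain ⟨f, hf, hfk⟩ := map_of_equiv r M P h3
    letI := h.module
    letI i1 := hM.module
    letI i2 := (hMn n hn).module
    haveI : IsScalarTower R (R ⧸ (Ideal.span {r ^ n} : Ideal R)) P := h.isScalarTower
    haveI : IsScalarTower R (R ⧸ (Ideal.span {r ^ n} : Ideal R)) M := (hMn n hn).isScalarTower
    have hle : (Ideal.span {r ^ n} : Ideal R) ≤ Ideal.span {r} :=
      Ideal.span_singleton_le_span_singleton.2 (dvd_pow_self r (by omega))
    letI : Algebra (R ⧸ (Ideal.span {r ^ n} : Ideal R)) (R ⧸ (Ideal.span {r} : Ideal R)) :=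
      (Ideal.Quotient.factor hle).toAlgebra
    haveI : IsScalarTower (R ⧸ (Ideal.span {r ^ n} : Ideal R))
        (R ⧸ (Ideal.span {r} : Ideal R)) M := by
      refine ⟨fun x y m => ?_⟩
      obtain ⟨x, rfl⟩ := Ideal.Quotient.mk_surjective x
      obtain ⟨y, rfl⟩ := Ideal.Quotient.mk_surjective y
      exact mul_smul x y m
    have hsur : Function.Surjective (algebraMap R (R ⧸ (Ideal.span {r ^ n} : Ideal R))) :=
      Ideal.Quotient.mk_surjective
    refine constRank_aux (A := R ⧸ (Ideal.span {r} : Ideal R)) _ (hrn n)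
      (Ideal.Quotient.factor_surjective hle) ?_ (f.extendScalarsOfSurjective hsur) hf hfk hc
    show RingHom.ker (Ideal.Quotient.factor hle) = _
    rw [Ideal.Quotient.factor_ker, Ideal.map_span, Set.image_singleton]
  · rintro P _ _ ⟨h1, h2, h3⟩
    obtain ⟨f, hf, hfk⟩ := map_of_equiv r M P h3
    letI := hM.module
    haveI : IsScalarTower R (R ⧸ (Ideal.span {r} : Ideal R)) M := hM.isScalarTower
    exact constRank_aux (A := R ⧸ (Ideal.span {r} : Ideal R)) r hr Ideal.Quotient.mk_surjective
      (Ideal.mk_ker) f hf hfk hc
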